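/- arXiv:2201.01481 — 10 statements merged into one kernel-verified Lean document; each statement's English description precedes it below -/
import Mathlib

section
/- For every real number r > 0, there is no quandle isomorphism between the conjugation quandle on S²₁(r) and the Azcan–Fenn quandle on the hyperboloid: there is no bijection f : S²₁(r) → S²₁ such that f(y⁻¹·x·y) = 2⟨f(x), f(y)⟩·f(y) − f(x) for all x, y ∈ S²₁(r), where S²₁ = {v ∈ ℝ³ : ⟨v,v⟩ = 1} and ⟨·,·⟩ is the Minkowski bilinear form. -/
/-- The diagonal matrix `D(r) = diag(e^r, e^{-r})` as an element of `SL(2, ℝ)`. -/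
noncomputable def Dmat (r : ℝ) : Matrix.SpecialLinearGroup (Fin 2) ℝ :=
  ⟨!![Real.exp r, 0; 0, Real.exp (-r)], by
    simp [Matrix.det_fin_two_of, ← Real.exp_add]⟩

/-- The conjugacy class `S²₁(r)` of `D(r)` in `SL(2, ℝ)`. -/
noncomputable def S21 (r : ℝ) : Set (Matrix.SpecialLinearGroup (Fin 2) ℝ) :=
  {g | ∃ h : Matrix.SpecialLinearGroup (Fin 2) ℝ, g = h⁻¹ * Dmat r * h}

/-- The Minkowski bilinear form on `ℝ³`. -/
def mink (x y : Fin 3 → ℝ) : ℝ := -(x 0 * y 0) + x 1 * y 1 + x 2 * y 2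

/-- The hyperboloid of one sheet `S²₁ = {x : ⟨x,x⟩ = 1}`. -/
def hyperboloid : Set (Fin 3 → ℝ) := {x | mink x x = 1}

/-- The Minkowski reflection `x ↦ 2⟨x,y⟩y - x` in a unit vector `y` is an involution. -/
theorem mink_reflection_involutive {y : Fin 3 → ℝ} (hy : y ∈ hyperboloid) (x : Fin 3 → ℝ) :
    (2 * mink ((2 * mink x y) • y - x) y) • y - ((2 * mink x y) • y - x) = x := by
  have hxy : mink ((2 * mink x y) • y - x) y = 2 * mink x y * mink y y - mink x y := by
    simp only [mink, Pi.sub_apply, Pi.smul_apply, smul_eq_mul]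
    ring
  rw [hxy, show mink y y = 1 from hy]
  module

theorem conj_mem_S21 {r : ℝ} {x : Matrix.SpecialLinearGroup (Fin 2) ℝ} (hx : x ∈ S21 r)
    (y : Matrix.SpecialLinearGroup (Fin 2) ℝ) : y⁻¹ * x * y ∈ S21 r := by
  obtain ⟨h, rfl⟩ := hx
  exact ⟨h * y, by group⟩

theorem Dmat_mem_S21 (r : ℝ) : Dmat r ∈ S21 r := ⟨1, by simp⟩

/-- For `r > 0` some element of `S²₁(r)` does not commute with `D(r)²`. -/
theorem exists_mem_S21_conj_conj_Dmat_ne {r : ℝ} (hr : 0 < r) :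
    ∃ x ∈ S21 r, (Dmat r)⁻¹ * ((Dmat r)⁻¹ * x * Dmat r) * Dmat r ≠ x := by
  let h : Matrix.SpecialLinearGroup (Fin 2) ℝ := ⟨!![1, 1; 0, 1], by simp⟩
  refine ⟨h⁻¹ * Dmat r * h, ⟨h, rfl⟩, fun hconj => ?_⟩
  have hentry := congrFun₂ (congrArg Subtype.val hconj) 0 1
  simp only [Matrix.SpecialLinearGroup.coe_mul, Matrix.SpecialLinearGroup.coe_inv] at hentry
  simp [h, Dmat, Matrix.adjugate_fin_two] at hentry
  have hb_lt : Real.exp (-r) < 1 := by simpa using hr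
  have ha : 1 < Real.exp r := by simpa using hr
  have hpow : Real.exp (-r) ^ 4 < 1 := pow_lt_one₀ (Real.exp_pos _).le hb_lt (by norm_num)
  nlinarith [mul_pos (sub_pos.2 (hb_lt.trans ha)) (sub_pos.2 hpow)]

theorem no_quandle_iso_S21r_to_hyperboloid (r : ℝ) (hr : 0 < r) :
    ¬ ∃ f : Matrix.SpecialLinearGroup (Fin 2) ℝ → (Fin 3 → ℝ),
      Set.BijOn f (S21 r) hyperboloid ∧
      ∀ x ∈ S21 r, ∀ y ∈ S21 r,
        f (y⁻¹ * x * y) = (2 * mink (f x) (f y)) • f y - f x := by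
  rintro ⟨f, hf, hop⟩
  obtain ⟨x, hx, hne⟩ := exists_mem_S21_conj_conj_Dmat_ne hr
  have hD := Dmat_mem_S21 r
  have hx' := conj_mem_S21 hx (Dmat r)
  refine hne (hf.injOn (conj_mem_S21 hx' (Dmat r)) hx ?_)
  rw [hop _ hx' _ hD, hop _ hx _ hD]
  exact mink_reflection_involutive (hf.mapsTo hD) (f x)
end

section
/- Let G be a group, k ≥ 1 an integer, n = 2k+1, and let c : ZMod n → G. Then c satisfies c(i+2) = c(i+1)⁻¹·c(i)·c(i+1) for all i ∈ ZMod n if and only if there exist x, y ∈ G with (x·y)^k·x = y·(x·y)^k such that for every natural number j with 2j < n one has c(2j) = (x·y)^{-j}·x·(x·y)^{j}, and for every natural number j with 2j+1 < n one has c(2j+1) = (x·y)^{-j}·y·(x·y)^{j} (necessarily x = c(0) and y = c(1)). -/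
section GroupIdentities

variable {G : Type*} [Group G]

/-- Conjugating `x` by `(x * y) ^ (j + 1)` is a crossing relation between the conjugates of `x`
and `y` by `(x * y) ^ j`. -/
lemma conj_mul_pow_succ_left (x y : G) (j : ℕ) :
    ((x * y) ^ (j + 1))⁻¹ * x * (x * y) ^ (j + 1) =
      (((x * y) ^ j)⁻¹ * y * (x * y) ^ j)⁻¹ * (((x * y) ^ j)⁻¹ * x * (x * y) ^ j) *
        (((x * y) ^ j)⁻¹ * y * (x * y) ^ j) := by
  rw [pow_succ']
  generalize (x * y) ^ j = q
  group

/-- Conjugating `y` by `(x * y) ^ (j + 1)` is a crossing relation between the conjugates of `y`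
by `(x * y) ^ j` and of `x` by `(x * y) ^ (j + 1)`. -/
lemma conj_mul_pow_succ_right (x y : G) (j : ℕ) :
    ((x * y) ^ (j + 1))⁻¹ * y * (x * y) ^ (j + 1) =
      (((x * y) ^ (j + 1))⁻¹ * x * (x * y) ^ (j + 1))⁻¹ *
        (((x * y) ^ j)⁻¹ * y * (x * y) ^ j) *
        (((x * y) ^ (j + 1))⁻¹ * x * (x * y) ^ (j + 1)) := by
  rw [pow_succ']
  generalize (x * y) ^ j = q
  group

lemma conj_mul_pow_eq_left {x y : G} {k : ℕ} (h : (x * y) ^ k * x = y * (x * y) ^ k) :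
    ((x * y) ^ k)⁻¹ * y * (x * y) ^ k = x := by
  rw [mul_assoc, ← h, inv_mul_cancel_left]

lemma conj_mul_pow_succ_eq_right {x y : G} {k : ℕ}
    (h : (x * y) ^ k * x = y * (x * y) ^ k) :
    ((x * y) ^ (k + 1))⁻¹ * x * (x * y) ^ (k + 1) = y := by
  have hcomm : x * ((x * y) ^ k * x) = (x * y) ^ k * x * y := by
    rw [h, ← mul_assoc, ← pow_succ', pow_succ, ← mul_assoc, h]
  rw [conj_mul_pow_succ_left, conj_mul_pow_eq_left h, mul_assoc, mul_assoc,
    inv_mul_eq_iff_eq_mul, mul_assoc, inv_mul_eq_iff_eq_mul, hcomm, mul_assoc]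

end GroupIdentities

theorem torus_knot_colorings_characterization {G : Type*} [Group G]
    (k : ℕ) (hk : 1 ≤ k) (n : ℕ) (hn : n = 2 * k + 1) (c : ZMod n → G) :
    (∀ i : ZMod n, c (i + 2) = (c (i + 1))⁻¹ * c i * c (i + 1)) ↔
      ∃ x y : G, (x * y) ^ k * x = y * (x * y) ^ k ∧
        (∀ j : ℕ, 2 * j < n →
          c ((2 * j : ℕ) : ZMod n) = ((x * y) ^ j)⁻¹ * x * (x * y) ^ j) ∧
        (∀ j : ℕ, 2 * j + 1 < n →
          c ((2 * j + 1 : ℕ) : ZMod n) = ((x * y) ^ j)⁻¹ * y * (x * y) ^ j) := by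
  constructor
  · intro h
    have hnat (m : ℕ) : c ((m + 2 : ℕ) : ZMod n) =
        (c ((m + 1 : ℕ) : ZMod n))⁻¹ * c (m : ZMod n) * c ((m + 1 : ℕ) : ZMod n) := by
      simpa using h m
    have key (j : ℕ) :
        c ((2 * j : ℕ) : ZMod n) = ((c 0 * c 1) ^ j)⁻¹ * c 0 * (c 0 * c 1) ^ j ∧
        c ((2 * j + 1 : ℕ) : ZMod n) = ((c 0 * c 1) ^ j)⁻¹ * c 1 * (c 0 * c 1) ^ j := by
      induction j with
      | zero => simp
      | succ j ih =>
        obtain ⟨hx, hy⟩ := ih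
        have hx' : c ((2 * (j + 1) : ℕ) : ZMod n) =
            ((c 0 * c 1) ^ (j + 1))⁻¹ * c 0 * (c 0 * c 1) ^ (j + 1) := by
          rw [conj_mul_pow_succ_left, ← hx, ← hy]
          exact hnat (2 * j)
        refine ⟨hx', ?_⟩
        rw [conj_mul_pow_succ_right, ← hx', ← hy]
        exact hnat (2 * j + 1)
    refine ⟨c 0, c 1, ?_, fun j _ => (key j).1, fun j _ => (key j).2⟩
    have hwrap := (key k).2
    rw [← hn, ZMod.natCast_self, mul_assoc, eq_inv_mul_iff_mul_eq] at hwrap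
    exact hwrap
  · rintro ⟨x, y, hxy, heven, hodd⟩ i
    have hx0 : c 0 = x := by simpa using heven 0 (by omega)
    have hy1 : c 1 = y := by simpa using hodd 0 (by omega)
    have heven' (j : ℕ) (hj : j ≤ k + 1) :
        c ((2 * j : ℕ) : ZMod n) = ((x * y) ^ j)⁻¹ * x * (x * y) ^ j := by
      rcases hj.lt_or_eq with hlt | rfl
      · exact heven j (by omega)
      · rw [conj_mul_pow_succ_eq_right hxy, show 2 * (k + 1) = n + 1 by omega]
        simpa using hy1
    have hodd' (j : ℕ) (hj : j ≤ k) :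
        c ((2 * j + 1 : ℕ) : ZMod n) = ((x * y) ^ j)⁻¹ * y * (x * y) ^ j := by
      rcases hj.lt_or_eq with hlt | rfl
      · exact hodd j (by omega)
      · rw [conj_mul_pow_eq_left hxy, ← hn, ZMod.natCast_self, hx0]
    have : NeZero n := ⟨by omega⟩
    obtain ⟨m, hm, rfl⟩ : ∃ m < n, (m : ZMod n) = i :=
      ⟨i.val, i.val_lt, ZMod.natCast_zmod_val i⟩
    suffices c ((m + 2 : ℕ) : ZMod n) =
        (c ((m + 1 : ℕ) : ZMod n))⁻¹ * c (m : ZMod n) * c ((m + 1 : ℕ) : ZMod n) by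
      simpa using this
    rcases Nat.even_or_odd' m with ⟨j, rfl | rfl⟩
    · rw [show 2 * j + 2 = 2 * (j + 1) by ring, heven' (j + 1) (by omega),
        heven' j (by omega), hodd' j (by omega), conj_mul_pow_succ_left]
    · rw [show 2 * j + 1 + 2 = 2 * (j + 1) + 1 by ring,
        show 2 * j + 1 + 1 = 2 * (j + 1) by ring, heven' (j + 1) (by omega),
        hodd' j (by omega), hodd' (j + 1) (by omega), conj_mul_pow_succ_right]
end

section
/- Let r > 0, k ≥ 1, x = D(r), and y the 2×2 real matrix with entries a, b (first row) and c, d (second row), where a·d − b·c = 1 and a + d = 2·cosh(r). Suppose (x·y)^k·x = y·(x·y)^k. Then b = 0 or c = 0 holds if and only if (a, b, c, d) = (e^r, 0, 0, e^{-r}), i.e., y = D(r). -/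
/-- Powers of an upper triangular matrix with nonnegative diagonal: the corner entry of the power
is a nonnegative multiple of the factor `b` of the original corner entry. -/
theorem upper_triangular_pow {p q t : ℝ} (hp : 0 ≤ p) (hq : 0 ≤ q) (ht : 0 ≤ t) (b : ℝ) (k : ℕ) :
    ∃ s : ℝ, 0 ≤ s ∧ !![p, b * t; 0, q] ^ k = !![p ^ k, b * s; 0, q ^ k] := by
  induction k with
  | zero => exact ⟨0, le_rfl, by simp [Matrix.one_fin_two]⟩
  | succ k ih =>
    obtain ⟨s, hs, h⟩ := ih
    refine ⟨p ^ k * t + s * q, by positivity, ?_⟩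
    rw [pow_succ, h, Matrix.mul_fin_two]
    ext i j
    fin_cases i <;> fin_cases j <;> simp <;> ring

/-- The upper triangular solutions of the coloring equation `(x * y) ^ k * x = y * (x * y) ^ k`. -/
theorem coloring_equation_upper_triangular {r : ℝ} (hr : 0 < r) {k : ℕ} {a b d : ℝ}
    (hdet : a * d = 1) (htr : a + d = 2 * Real.cosh r)
    (heq : (!![Real.exp r, 0; 0, Real.exp (-r)] * !![a, b; 0, d]) ^ k *
        !![Real.exp r, 0; 0, Real.exp (-r)] =
      !![a, b; 0, d] * (!![Real.exp r, 0; 0, Real.exp (-r)] * !![a, b; 0, d]) ^ k) :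
    a = Real.exp r ∧ b = 0 ∧ d = Real.exp (-r) := by
  have hcosh := Real.cosh_pos r
  have ha : 0 < a := by
    by_contra! h
    nlinarith
  have hd : 0 < d := by
    by_contra! h
    nlinarith
  have hE := Real.exp_pos r
  have hF := Real.exp_pos (-r)
  have hlt : Real.exp (-r) < Real.exp r := Real.exp_lt_exp.2 (by linarith)
  have hprod : !![Real.exp r, 0; 0, Real.exp (-r)] * !![a, b; 0, d] =
      !![Real.exp r * a, b * Real.exp r; 0, Real.exp (-r) * d] := by
    rw [Matrix.mul_fin_two]
    ext i j
    fin_cases i <;> fin_cases j <;> simp <;> ring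
  obtain ⟨s, hs, hpow⟩ := upper_triangular_pow (p := Real.exp r * a) (q := Real.exp (-r) * d)
    (by positivity) (by positivity) hE.le b k
  rw [hprod, hpow, Matrix.mul_fin_two, Matrix.mul_fin_two] at heq
  have h00 := congrFun (congrFun heq 0) 0
  have h01 := congrFun (congrFun heq 0) 1
  simp only [Matrix.of_apply, Matrix.cons_val', Matrix.cons_val_zero, Matrix.cons_val_one,
    Matrix.cons_val_fin_one, mul_zero, add_zero, zero_add] at h00 h01
  have hpk : 0 < (Real.exp r * a) ^ k := by positivity
  have hqk : 0 < (Real.exp (-r) * d) ^ k := by positivity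
  have haE : a = Real.exp r := mul_left_cancel₀ hpk.ne' (by linarith)
  refine ⟨haE, ?_, by rw [Real.cosh_eq] at htr; linarith⟩
  have hfac : b * (s * (a - Real.exp (-r)) + (Real.exp (-r) * d) ^ k) = 0 := by linarith
  have hpos : 0 < s * (a - Real.exp (-r)) + (Real.exp (-r) * d) ^ k :=
    add_pos_of_nonneg_of_pos (mul_nonneg hs (by linarith)) hqk
  exact (mul_eq_zero.1 hfac).resolve_right hpos.ne'

/-- The coloring equation passes from `y` to `yᵀ` when `x` is symmetric. -/
theorem coloring_equation_transpose {n R : Type*} [Fintype n] [DecidableEq n] [CommRing R]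
    {x y : Matrix n n R} (hx : x.transpose = x) {k : ℕ}
    (heq : (x * y) ^ k * x = y * (x * y) ^ k) :
    (x * y.transpose) ^ k * x = y.transpose * (x * y.transpose) ^ k := by
  have h := congrArg Matrix.transpose heq
  simp only [Matrix.transpose_mul, Matrix.transpose_pow, hx] at h
  have hswap (u v : Matrix n n R) : u * (v * u) ^ k = (u * v) ^ k * u :=
    (show SemiconjBy u (v * u) (u * v) by simp [SemiconjBy, mul_assoc]).pow_right k
  rw [← hswap, h, hswap]

theorem coloring_equation_case_b_or_c_zero
    (r : ℝ) (hr : 0 < r) (k : ℕ) (hk : 1 ≤ k) (a b c d : ℝ)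
    (hdet : a * d - b * c = 1) (htr : a + d = 2 * Real.cosh r)
    (x y : Matrix (Fin 2) (Fin 2) ℝ)
    (hx : x = !![Real.exp r, 0; 0, Real.exp (-r)])
    (hy : y = !![a, b; c, d])
    (heq : (x * y) ^ k * x = y * (x * y) ^ k) :
    (b = 0 ∨ c = 0) ↔ (a = Real.exp r ∧ b = 0 ∧ c = 0 ∧ d = Real.exp (-r)) := by
  refine ⟨?_, fun h => Or.inl h.2.1⟩
  rintro (rfl | rfl)
  · have hxt : x.transpose = x := by
      rw [hx]
      ext i j
      fin_cases i <;> fin_cases j <;> rfl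
    have hyt : y.transpose = !![a, c; 0, d] := by
      rw [hy]
      ext i j
      fin_cases i <;> fin_cases j <;> rfl
    have h := coloring_equation_transpose hxt heq
    rw [hyt, hx] at h
    obtain ⟨h₁, h₂, h₃⟩ := coloring_equation_upper_triangular hr (by linarith) htr h
    exact ⟨h₁, rfl, h₂, h₃⟩
  · subst hx hy
    obtain ⟨h₁, h₂, h₃⟩ := coloring_equation_upper_triangular hr (by linarith) htr heq
    exact ⟨h₁, h₂, rfl, h₃⟩
end

section
/- Let r > 0, k ≥ 1, x = D(r), and y the 2×2 real matrix with entries a, b (first row) and c, d (second row), where a·d − b·c = 1 and a + d = 2·cosh(r). Let λ, μ ∈ ℂ be the two roots of t² − (a·e^r + d·e^{-r})·t + 1 = 0 (so λ·μ = 1 and λ + μ = a·e^r + d·e^{-r}). If b ≠ 0, c ≠ 0, and λ ≠ μ, then (x·y)^k·x = y·(x·y)^k holds if and only if λ^k − μ^k = λ^{k+1} − μ^{k+1}. -/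
/-- A scalar family `w` controls both the defect `M ^ k * x - y * M ^ k` and the difference of
consecutive power differences of the roots, since both satisfy the recurrence of `M = x * y`. -/
lemma exists_defect_eq_smul {A : Type*} [Ring A] [Algebra ℝ A] (x y : A) (s : ℝ) (lam mu : ℂ)
    (hprod : lam * mu = 1) (hsum : lam + mu = (s : ℂ))
    (hquad : (x * y) ^ 2 = s • (x * y) - 1)
    (hbraid : x * y * x - y * (x * y) = (s - 1) • (x - y)) (k : ℕ) :
    ∃ w : ℝ, (x * y) ^ k * x - y * (x * y) ^ k = w • (x - y) ∧
      (lam ^ (k + 1) - mu ^ (k + 1)) - (lam ^ k - mu ^ k) = (lam - mu) * w := by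
  induction k using Nat.twoStepInduction with
  | zero => exact ⟨1, by simp, by simp⟩
  | one =>
    refine ⟨s - 1, by simpa using hbraid, ?_⟩
    push_cast
    rw [← hsum]
    ring
  | more k ih₀ ih₁ =>
    obtain ⟨w₀, hw₀, hl₀⟩ := ih₀
    obtain ⟨w₁, hw₁, hl₁⟩ := ih₁
    refine ⟨s * w₁ - w₀, ?_, ?_⟩
    · have hpow : (x * y) ^ (k + 2) = s • (x * y) ^ (k + 1) - (x * y) ^ k := by
        rw [pow_add, hquad, mul_sub, mul_smul_comm, ← pow_succ, mul_one]
      rw [sub_smul, mul_smul, ← hw₀, ← hw₁, hpow, sub_mul, mul_sub, smul_mul_assoc,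
        mul_smul_comm, smul_sub]
      abel
    · push_cast
      rw [← hsum]
      linear_combination (lam + mu) * hl₁ - hl₀ -
        (lam ^ (k + 1) - mu ^ (k + 1) - (lam ^ k - mu ^ k)) * hprod

theorem coloring_equation_case_distinct_eigenvalues
    (r : ℝ) (hr : 0 < r) (k : ℕ) (hk : 1 ≤ k) (a b c d : ℝ)
    (hdet : a * d - b * c = 1) (htr : a + d = 2 * Real.cosh r)
    (x y : Matrix (Fin 2) (Fin 2) ℝ)
    (hx : x = !![Real.exp r, 0; 0, Real.exp (-r)])
    (hy : y = !![a, b; c, d])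
    (lam mu : ℂ) (hprod : lam * mu = 1)
    (hsum : lam + mu = ((a * Real.exp r + d * Real.exp (-r) : ℝ) : ℂ))
    (hb : b ≠ 0) (hc : c ≠ 0) (hne : lam ≠ mu) :
    (x * y) ^ k * x = y * (x * y) ^ k ↔
      lam ^ k - mu ^ k = lam ^ (k + 1) - mu ^ (k + 1) := by
  have hexp : Real.exp r * Real.exp (-r) = 1 := by rw [← Real.exp_add]; simp
  have htr' : a + d = Real.exp r + Real.exp (-r) := by rw [htr, Real.cosh_eq]; ring
  have hxy : x - y ≠ 0 := fun h => hb (by simpa [hx, hy] using congrFun₂ h 0 1)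
  generalize Real.exp r = e at *
  generalize Real.exp (-r) = f at *
  have hquad : (x * y) ^ 2 = (a * e + d * f) • (x * y) - 1 := by
    subst hx hy
    ext i j
    fin_cases i <;> fin_cases j <;> simp [pow_two, Matrix.mul_apply, Fin.sum_univ_two]
    · linear_combination -e * f * hdet - hexp
    · ring
    · ring
    · linear_combination -e * f * hdet - hexp
  have hbraid : x * y * x - y * (x * y) = (a * e + d * f - 1) • (x - y) := by
    subst hx hy
    ext i j
    fin_cases i <;> fin_cases j <;> simp
    · linear_combination f * hdet - htr' - d * hexp
    · linear_combination b * hexp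
    · linear_combination c * hexp
    · linear_combination e * hdet - htr' - a * hexp
  obtain ⟨w, hw, hl⟩ :=
    exists_defect_eq_smul x y (a * e + d * f) lam mu hprod hsum hquad hbraid k
  rw [← sub_eq_zero, hw, smul_eq_zero, or_iff_left hxy, eq_comm (a := lam ^ k - mu ^ k),
    ← sub_eq_zero (a := lam ^ (k + 1) - mu ^ (k + 1)), hl, mul_eq_zero,
    or_iff_right (sub_ne_zero.2 hne), Complex.ofReal_eq_zero]
end

section
/- Let r > 0, k ≥ 1, x = D(r), and y the 2×2 real matrix with entries a, b (first row) and c, d (second row), where a·d − b·c = 1 and a + d = 2·cosh(r). If b ≠ 0, c ≠ 0, and the characteristic polynomial t² − (a·e^r + d·e^{-r})·t + 1 of x·y has a repeated root (equivalently (a·e^r + d·e^{-r})² = 4), then (x·y)^k·x ≠ y·(x·y)^k. -/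
/-- Powers of an element annihilated by `(t - s)²`, where `s² = 1`. -/
lemma pow_eq_of_mul_self_eq_two_smul_sub_one {A : Type*} [Ring A] [Algebra ℝ A] {M : A} {s : ℝ}
    (hs : s ^ 2 = 1) (hM : M * M = (2 * s) • M - 1) (k : ℕ) :
    M ^ k = s ^ k • ((1 - k : ℝ) • (1 : A) + (k * s) • M) := by
  induction k with
  | zero => simp
  | succ k ih =>
    rw [pow_succ, ih, smul_mul_assoc, add_mul, smul_mul_assoc, smul_mul_assoc, hM, one_mul]
    push_cast
    match_scalars
    · linear_combination s ^ k * (k - 1) * hs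
    · ring

theorem coloring_equation_case_repeated_eigenvalue
    (r : ℝ) (hr : 0 < r) (k : ℕ) (hk : 1 ≤ k) (a b c d : ℝ)
    (hdet : a * d - b * c = 1) (htr : a + d = 2 * Real.cosh r)
    (x y : Matrix (Fin 2) (Fin 2) ℝ)
    (hx : x = !![Real.exp r, 0; 0, Real.exp (-r)])
    (hy : y = !![a, b; c, d])
    (hb : b ≠ 0) (hc : c ≠ 0)
    (hrep : (a * Real.exp r + d * Real.exp (-r)) ^ 2 = 4) :
    (x * y) ^ k * x ≠ y * (x * y) ^ k := by
  intro h
  have hEF : Real.exp r * Real.exp (-r) = 1 := by rw [← Real.exp_add]; simp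
  generalize Real.exp r = E at *
  generalize Real.exp (-r) = F at *
  obtain ⟨s, hT⟩ : ∃ s, a * E + d * F = 2 * s := ⟨(a * E + d * F) / 2, by ring⟩
  have hs : s ^ 2 = 1 := by rw [hT] at hrep; linarith
  have hxy : x * y = !![E * a, E * b; F * c, F * d] := by
    subst hx hy
    simp
  have hM : (x * y) * (x * y) = (2 * s) • (x * y) - 1 := by
    rw [hxy, Matrix.mul_fin_two, Matrix.one_fin_two, ← hT]
    ext i j
    fin_cases i <;> fin_cases j <;> simp
    · linear_combination (b * c - a * d) * hEF - hdet
    · ring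
    · ring
    · linear_combination (b * c - a * d) * hEF - hdet
  have hs0 : s ≠ 0 := by rintro rfl; norm_num at hs
  rw [pow_eq_of_mul_self_eq_two_smul_sub_one hs hM, smul_mul_assoc, mul_smul_comm] at h
  have h01 := congrFun (congrFun (smul_right_injective _ (pow_ne_zero k hs0) h) 0) 1
  rw [hxy, hx, hy] at h01
  simp [Matrix.mul_apply, Fin.sum_univ_two, Matrix.add_apply] at h01
  have hks : (k : ℝ) * (s - 1) = 1 := by
    apply mul_left_cancel₀ hb
    linear_combination h01 - k * s * b * hEF + k * s * b * hT + 2 * k * b * hs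
  have hk0 : (1 : ℝ) ≤ k := by exact_mod_cast hk
  have hs1 : s ≤ 1 := by nlinarith
  nlinarith
end

section
/- Let m be a positive integer and let λ, μ ∈ ℂ satisfy λ·μ = 1, λ ≠ μ, and λ^m − μ^m = λ^{m+1} − μ^{m+1}. Then there exists an odd integer j with 1 ≤ j ≤ 4m+1 and j ≠ 2m+1 such that λ = exp(π·j·i/(2m+1)). -/
/-- Cancelling the factor `1 - lam` reduces the eigenvalue equation to `lam ^ (2 * m + 1) = -1`. -/
theorem pow_eq_neg_one_of_eigenvalue_equation
    (m : ℕ) (lam mu : ℂ) (hprod : lam * mu = 1) (hne : lam ≠ mu)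
    (heq : lam ^ m - mu ^ m = lam ^ (m + 1) - mu ^ (m + 1)) :
    lam ^ (2 * m + 1) = -1 := by
  have hone : 1 - lam ≠ 0 := by
    intro h
    obtain rfl : lam = 1 := (sub_eq_zero.mp h).symm
    exact hne (by simpa using hprod.symm)
  have hpow : lam ^ m * mu ^ m = 1 := by rw [← mul_pow, hprod, one_pow]
  have hfactor : (lam ^ (2 * m + 1) + 1) * (1 - lam) = 0 := by
    linear_combination lam ^ (m + 1) * heq + (lam - lam * mu) * hpow - hprod
  exact eq_neg_of_add_eq_zero_left ((mul_eq_zero.mp hfactor).resolve_right hone)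

/-- The solutions of `z ^ n = -1` are the numbers `exp (π * j * I / n)` with `j < 2 * n` odd. -/
theorem exists_odd_eq_exp_of_pow_eq_neg_one {n : ℕ} (hn : n ≠ 0) {z : ℂ} (hz : z ^ n = -1) :
    ∃ j : ℕ, Odd j ∧ j < 2 * n ∧ z = Complex.exp (Real.pi * j * Complex.I / n) := by
  have hn' : (n : ℂ) ≠ 0 := Nat.cast_ne_zero.mpr hn
  have : NeZero (2 * n) := ⟨by omega⟩
  obtain ⟨j, hj, hexp⟩ := (Complex.isPrimitiveRoot_exp (2 * n) (NeZero.ne _)).eq_pow_of_pow_eq_one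
    (show z ^ (2 * n) = 1 by rw [mul_comm, pow_mul, hz]; norm_num)
  have hz' : z = Complex.exp (Real.pi * j * Complex.I / n) := by
    rw [← hexp, ← Complex.exp_nat_mul]
    congr 1
    push_cast
    field_simp
  refine ⟨j, ?_, hj, hz'⟩
  have hsign : z ^ n = (-1) ^ j := by
    rw [hz', ← Complex.exp_nat_mul, ← Complex.exp_pi_mul_I, ← Complex.exp_nat_mul]
    congr 1
    field_simp
  by_contra hodd
  rw [hz, (Nat.not_odd_iff_even.mp hodd).neg_one_pow] at hsign
  norm_num at hsign

theorem eigenvalue_equation_solutions_exp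
    (m : ℕ) (hm : 1 ≤ m) (lam mu : ℂ)
    (hprod : lam * mu = 1) (hne : lam ≠ mu)
    (heq : lam ^ m - mu ^ m = lam ^ (m + 1) - mu ^ (m + 1)) :
    ∃ j : ℕ, Odd j ∧ 1 ≤ j ∧ j ≤ 4 * m + 1 ∧ j ≠ 2 * m + 1 ∧
      lam = Complex.exp (Real.pi * j * Complex.I / (2 * m + 1)) := by
  obtain ⟨j, hodd, hj, hexp⟩ := exists_odd_eq_exp_of_pow_eq_neg_one (Nat.succ_ne_zero (2 * m))
    (pow_eq_neg_one_of_eigenvalue_equation m lam mu hprod hne heq)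
  refine ⟨j, hodd, hodd.pos, by omega, ?_, by simpa using hexp⟩
  rintro rfl
  have hcast : ((2 * m + 1 : ℕ) : ℂ) ≠ 0 := Nat.cast_ne_zero.mpr (Nat.succ_ne_zero _)
  obtain rfl : lam = -1 := by
    rw [hexp, ← Complex.exp_pi_mul_I]
    congr 1
    rw [mul_right_comm]
    exact mul_div_cancel_right₀ _ hcast
  exact hne (by linear_combination hprod)
end

section
/- Let m be a positive integer and let λ, μ ∈ ℂ satisfy λ·μ = 1, λ ≠ μ, and λ^m − μ^m = λ^{m+1} − μ^{m+1}. Then there exists an odd integer j with 1 ≤ j ≤ 2m−1 such that λ + μ = 2·cos(π·j/(2m+1)). -/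
/-- The equation `λ ^ m - μ ^ m = λ ^ (m + 1) - μ ^ (m + 1)` for distinct mutually inverse
`λ`, `μ` says that `-λ` is a root of unity of order dividing `2 * m + 1`. -/
theorem neg_pow_eq_one_of_pow_sub_pow_eq {K : Type*} [Field K] {m : ℕ} {a b : K}
    (hprod : a * b = 1) (hne : a ≠ b) (heq : a ^ m - b ^ m = a ^ (m + 1) - b ^ (m + 1)) :
    (-a) ^ (2 * m + 1) = 1 := by
  have ha : a - 1 ≠ 0 := by
    intro h
    obtain rfl : a = 1 := sub_eq_zero.mp h
    exact hne (by simpa using hprod.symm)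
  have hpow : a ^ m * b ^ m = 1 := by rw [← mul_pow, hprod, one_pow]
  rw [Odd.neg_pow ⟨m, rfl⟩]
  apply mul_left_cancel₀ ha
  linear_combination a ^ (m + 1) * heq + (a - a * b) * hpow - hprod

/-- A nontrivial `n`-th root of unity plus its inverse is `2 * cos (2 * π * k / n)`. -/
theorem Complex.exists_add_eq_two_mul_cos_of_pow_eq_one {n : ℕ} (hn : n ≠ 0) {z w : ℂ}
    (hz : z ^ n = 1) (hz1 : z ≠ 1) (hzw : z * w = 1) :
    ∃ k : ℕ, 0 < k ∧ k < n ∧ z + w = ((2 * Real.cos (2 * Real.pi * k / n) : ℝ) : ℂ) := by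
  have : NeZero n := ⟨hn⟩
  obtain ⟨k, hk, rfl⟩ := (Complex.isPrimitiveRoot_exp n hn).eq_pow_of_pow_eq_one hz
  refine ⟨k, Nat.pos_of_ne_zero ?_, hk, ?_⟩
  · rintro rfl
    simp at hz1
  · rw [eq_inv_of_mul_eq_one_right hzw, ← Complex.exp_nat_mul, ← Complex.exp_neg]
    push_cast
    rw [Complex.two_cos]
    congr 2 <;> ring

theorem eigenvalue_equation_solutions_cos
    (m : ℕ) (hm : 1 ≤ m) (lam mu : ℂ)
    (hprod : lam * mu = 1) (hne : lam ≠ mu)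
    (heq : lam ^ m - mu ^ m = lam ^ (m + 1) - mu ^ (m + 1)) :
    ∃ j : ℕ, Odd j ∧ 1 ≤ j ∧ j ≤ 2 * m - 1 ∧
      lam + mu = ((2 * Real.cos (Real.pi * j / (2 * m + 1)) : ℝ) : ℂ) := by
  have hlam : -lam ≠ 1 := by
    intro h
    have h' : lam = -1 := by linear_combination -h
    exact hne (by linear_combination (1 - mu) * h' + hprod)
  obtain ⟨k, hk0, hkn, hk⟩ := Complex.exists_add_eq_two_mul_cos_of_pow_eq_one
    (by omega) (neg_pow_eq_one_of_pow_sub_pow_eq hprod hne heq) hlam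
    (show -lam * -mu = 1 by rw [neg_mul_neg, hprod])
  have hsum : lam + mu = ((2 * -Real.cos (2 * Real.pi * k / (2 * m + 1)) : ℝ) : ℂ) := by
    push_cast at hk ⊢
    linear_combination -hk
  have hn : (2 * m + 1 : ℝ) ≠ 0 := by positivity
  rw [hsum]
  obtain hkm | hkm := le_or_gt k m
  · refine ⟨2 * m + 1 - 2 * k, ⟨m - k, by omega⟩, by omega, by omega, ?_⟩
    rw [← Real.cos_pi_sub, Nat.cast_sub (by omega)]
    congr 3
    push_cast
    field_simp
  · refine ⟨2 * k - (2 * m + 1), ⟨k - m - 1, by omega⟩, by omega, by omega, ?_⟩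
    rw [← Real.cos_sub_pi, Nat.cast_sub (by omega)]
    congr 3
    push_cast
    field_simp
end

section
/- Let n ≥ 3 be odd, let j be an odd integer with 1 ≤ j ≤ n−2, set θ = π·j/(2n), and let r > 0. Let x = D(r) and let y be the 2×2 real matrix with entries a, b (first row) and c, d (second row), where a = (−e^{-r}·cosh(r) + cos(2θ))/sinh(r), d = (e^r·cosh(r) − cos(2θ))/sinh(r), and b·c = −4·sin²(θ)·(sin²(θ) + sinh²(r))/sinh²(r). Then (x·y)^n = −I, where I is the 2×2 identity matrix. -/
/-- Powers of an element that is a root of `X ^ 2 - 2 cos φ X + 1`. -/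
lemma sin_smul_pow_succ {A : Type*} [Ring A] [Algebra ℝ A] {M : A} {φ : ℝ}
    (hM : M * M = (2 * Real.cos φ) • M - 1) (k : ℕ) :
    Real.sin φ • M ^ (k + 1) = Real.sin ((k + 1) * φ) • M - Real.sin (k * φ) • (1 : A) := by
  induction k with
  | zero => simp
  | succ k ih =>
    have hsin : Real.sin ((k + 1 + 1) * φ) =
        2 * Real.cos φ * Real.sin ((k + 1) * φ) - Real.sin (k * φ) := by
      rw [show ((k : ℝ) + 1 + 1) * φ = (k + 1) * φ + φ by ring,
        show (k : ℝ) * φ = (k + 1) * φ - φ by ring, Real.sin_add, Real.sin_sub]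
      ring
    rw [pow_succ, ← smul_mul_assoc, ih, sub_mul, smul_mul_assoc, smul_mul_assoc, hM, one_mul]
    push_cast
    rw [hsin]
    module

/-- The Cayley–Hamilton theorem for `2 × 2` matrices of determinant one. -/
lemma Matrix.mul_self_eq_trace_smul_sub_one {R : Type*} [CommRing R]
    {M : Matrix (Fin 2) (Fin 2) R} (hdet : M.det = 1) : M * M = M.trace • M - 1 := by
  rw [Matrix.det_fin_two] at hdet
  ext i k
  fin_cases i <;> fin_cases k <;>
    simp [Matrix.mul_apply, Fin.sum_univ_two, Matrix.trace_fin_two] <;>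
    first | ring1 | linear_combination -hdet

theorem xy_pow_n_eq_neg_one
    (n : ℕ) (hn3 : 3 ≤ n) (hnodd : Odd n)
    (j : ℕ) (hjodd : Odd j) (hj1 : 1 ≤ j) (hjn : j ≤ n - 2)
    (θ : ℝ) (hθ : θ = Real.pi * j / (2 * n))
    (r : ℝ) (hr : 0 < r) (a b c d : ℝ)
    (ha : a = (-Real.exp (-r) * Real.cosh r + Real.cos (2 * θ)) / Real.sinh r)
    (hd : d = (Real.exp r * Real.cosh r - Real.cos (2 * θ)) / Real.sinh r)
    (hbc : b * c = -(4 * Real.sin θ ^ 2 * (Real.sin θ ^ 2 + Real.sinh r ^ 2))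
        / Real.sinh r ^ 2)
    (x y : Matrix (Fin 2) (Fin 2) ℝ)
    (hx : x = !![Real.exp r, 0; 0, Real.exp (-r)])
    (hy : y = !![a, b; c, d]) :
    (x * y) ^ n = !![-1, 0; 0, -1] := by
  have hs : Real.sinh r ≠ 0 := (Real.sinh_pos_iff.2 hr).ne'
  have he : Real.exp r * Real.exp (-r) = 1 := by rw [← Real.exp_add]; simp
  have hn : (0 : ℝ) < n := by exact_mod_cast (by omega : 0 < n)
  have hj : (0 : ℝ) < j := by exact_mod_cast hj1
  have hjn' : (j : ℝ) < n := by exact_mod_cast (by omega : j < n)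
  have hnθ : (n : ℝ) * (2 * θ) = j * Real.pi := by rw [hθ]; field_simp
  have hsin : 0 < Real.sin (2 * θ) := by
    apply Real.sin_pos_of_pos_of_lt_pi <;> nlinarith [Real.pi_pos]
  have htrace : (x * y).trace = 2 * Real.cos (2 * θ) := by
    simp only [hx, hy, Matrix.trace_fin_two, Matrix.mul_fin_two, Matrix.of_apply,
      Matrix.cons_val', Matrix.cons_val_zero, Matrix.cons_val_one, Matrix.cons_val_fin_one]
    rw [ha, hd]
    field_simp
    linear_combination -2 * Real.cos (2 * θ) * Real.sinh_eq r
  have hdet : (x * y).det = 1 := by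
    have had : a * d - b * c = 1 := by
      rw [hbc, ha, hd, Real.cos_two_mul, Real.cos_sq']
      field_simp
      linear_combination (1 - 4 * Real.sin θ ^ 2) * Real.cosh_sq r
        - Real.cosh r ^ 2 * he
        - 2 * (1 - 2 * Real.sin θ ^ 2) * Real.cosh r * Real.cosh_eq r
    rw [Matrix.det_mul, hx, hy, Matrix.det_fin_two_of, Matrix.det_fin_two_of, he, had]
    ring
  have hM := Matrix.mul_self_eq_trace_smul_sub_one hdet
  rw [htrace] at hM
  obtain ⟨k, rfl⟩ : ∃ k, n = k + 1 := ⟨n - 1, by omega⟩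
  have hpow := sin_smul_pow_succ hM k
  push_cast at hnθ
  have hsink : Real.sin (k * (2 * θ)) = Real.sin (2 * θ) := by
    rw [show (k : ℝ) * (2 * θ) = j * Real.pi - 2 * θ by linarith, Real.sin_sub,
      Real.sin_nat_mul_pi, Real.cos_nat_mul_pi, hjodd.neg_one_pow]
    ring
  rw [hnθ, Real.sin_nat_mul_pi, hsink, zero_smul, zero_sub, ← smul_neg] at hpow
  rw [smul_right_injective _ hsin.ne' hpow, Matrix.one_fin_two]
  simp
end

section
/- Let k ≥ 1, n = 2k+1, and r > 0. Let x = D(r) and let y be a 2×2 real matrix with entries a, b (first row) and c, d (second row) satisfying a·d − b·c = 1 and a + d = 2·cosh(r). Then (x·y)^k·x = y·(x·y)^k if and only if either (a, b, c, d) = (e^r, 0, 0, e^{-r}), or there exists an odd integer j with 1 ≤ j ≤ n−2 such that, setting θ = π·j/(2n): a = (−e^{-r}·cosh(r) + cos(2θ))/sinh(r), d = (e^r·cosh(r) − cos(2θ))/sinh(r), and b·c = −4·sin²(θ)·(sin²(θ) + sinh²(r))/sinh²(r). -/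
/-- The polynomials `U_k(t/2) - U_{k-1}(t/2)`, with `U` the Chebyshev polynomials of the second
kind. -/
def chebyshevDiff (t : ℝ) : ℕ → ℝ
  | 0 => 1
  | 1 => t - 1
  | k + 2 => t * chebyshevDiff t (k + 1) - chebyshevDiff t k

theorem cos_mul_chebyshevDiff (z : ℝ) (k : ℕ) :
    Real.cos z * chebyshevDiff (2 * Real.cos (2 * z)) k = Real.cos ((2 * k + 1) * z) := by
  induction k using Nat.twoStepInduction with
  | zero => simp [chebyshevDiff]
  | one =>
    have h : ((2 * (1 : ℕ) + 1 : ℝ)) * z = 3 * z := by push_cast; ring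
    rw [h, Real.cos_three_mul, chebyshevDiff, Real.cos_two_mul]
    ring
  | more k ih₀ ih₁ =>
    have h₀ : (2 * (k : ℝ) + 1) * z = (2 * ((k + 1 : ℕ) : ℝ) + 1) * z - 2 * z := by
      push_cast; ring
    have h₂ : (2 * ((k + 2 : ℕ) : ℝ) + 1) * z = (2 * ((k + 1 : ℕ) : ℝ) + 1) * z + 2 * z := by
      push_cast; ring
    rw [h₀, Real.cos_sub] at ih₀
    rw [h₂, Real.cos_add, chebyshevDiff]
    linear_combination 2 * Real.cos (2 * z) * ih₁ - ih₀

theorem pos_of_linear_recurrence {u : ℕ → ℝ} {s : ℝ} (hs : 2 ≤ s)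
    (hu : ∀ k, u (k + 2) = s * u (k + 1) - u k) (h₀ : 0 < u 0) (h₁ : u 0 ≤ u 1) (k : ℕ) :
    0 < u k := by
  suffices h : 0 < u k ∧ u k ≤ u (k + 1) from h.1
  induction k with
  | zero => exact ⟨h₀, h₁⟩
  | succ k ih =>
    have hpos : 0 < u (k + 1) := ih.1.trans_le ih.2
    refine ⟨hpos, ?_⟩
    rw [hu]
    nlinarith [mul_nonneg (sub_nonneg.2 hs) hpos.le, ih.2]

theorem abs_lt_two_of_chebyshevDiff_eq_zero {t : ℝ} {k : ℕ} (h : chebyshevDiff t k = 0) :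
    |t| < 2 := by
  by_contra! ht
  rcases le_abs.1 ht with ht | ht
  · have := pos_of_linear_recurrence (u := chebyshevDiff t) ht (fun _ => by rw [chebyshevDiff])
      (by norm_num [chebyshevDiff]) (by simp only [chebyshevDiff]; linarith) k
    exact this.ne' h
  · have := pos_of_linear_recurrence (u := fun k => (-1) ^ k * chebyshevDiff t k) ht
      (fun k => by simp only [chebyshevDiff]; ring) (by norm_num [chebyshevDiff])
      (by simp only [chebyshevDiff]; linarith) k
    simp [h] at this

theorem chebyshevDiff_eq_zero_iff {t : ℝ} {k : ℕ} :
    chebyshevDiff t k = 0 ↔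
      ∃ j : ℕ, Odd j ∧ j < 2 * k + 1 ∧ t = 2 * Real.cos (Real.pi * j / (2 * k + 1)) := by
  have hn : (0 : ℝ) < 2 * k + 1 := by positivity
  constructor
  · intro h
    obtain ⟨hlo, hhi⟩ := abs_lt.1 (abs_lt_two_of_chebyshevDiff_eq_zero h)
    set φ := Real.arccos (t / 2)
    have hcos : Real.cos φ = t / 2 := Real.cos_arccos (by linarith) (by linarith)
    have hpos : 0 < φ := Real.arccos_pos.2 (by linarith)
    have hlt : φ < Real.pi := Real.arccos_lt_pi.2 (by linarith)
    have key := cos_mul_chebyshevDiff (φ / 2) k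
    rw [mul_div_cancel₀ φ two_ne_zero, hcos, mul_div_cancel₀ t two_ne_zero, h, mul_zero] at key
    obtain ⟨m, hm⟩ := Real.cos_eq_zero_iff.1 key.symm
    have hm' : φ * (2 * k + 1) = Real.pi * (2 * m + 1) := by linarith
    have h₀ : (0 : ℝ) < 2 * m + 1 :=
      pos_of_mul_pos_right (hm' ▸ mul_pos hpos hn) Real.pi_pos.le
    have h₁ : (2 * m + 1 : ℝ) < 2 * k + 1 := by
      refine lt_of_mul_lt_mul_left ?_ Real.pi_pos.le
      rw [← hm']
      exact mul_lt_mul_of_pos_right hlt hn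
    norm_cast at h₀ h₁
    lift m to ℕ using by omega
    refine ⟨2 * m + 1, odd_two_mul_add_one m, by omega, ?_⟩
    have : Real.pi * ((2 * m + 1 : ℕ) : ℝ) / (2 * k + 1) = φ := by
      rw [div_eq_iff hn.ne', hm']
      push_cast
      ring
    rw [this, hcos]
    ring
  · rintro ⟨j, hj, hjn, rfl⟩
    obtain ⟨m, rfl⟩ := hj
    have hjn' : ((2 * m + 1 : ℕ) : ℝ) < 2 * k + 1 := by exact_mod_cast hjn
    set z := Real.pi * ((2 * m + 1 : ℕ) : ℝ) / (2 * k + 1) / 2 with hz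
    have key := cos_mul_chebyshevDiff z k
    have hmul : (2 * k + 1) * z = (2 * ((m : ℤ) : ℝ) + 1) * Real.pi / 2 := by
      rw [hz]
      field_simp
      push_cast
      ring
    rw [Real.cos_eq_zero_iff.2 ⟨m, hmul⟩, hz, mul_div_cancel₀ _ two_ne_zero, ← hz] at key
    refine (mul_eq_zero.1 key).resolve_left (Real.cos_pos_of_mem_Ioo ⟨?_, ?_⟩).ne'
    · have : 0 ≤ z := by positivity
      linarith [Real.pi_pos]
    · have : Real.pi * ((2 * m + 1 : ℕ) : ℝ) / (2 * k + 1) < Real.pi := by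
        rw [div_lt_iff₀ hn]
        exact mul_lt_mul_of_pos_left hjn' Real.pi_pos
      linarith

theorem mul_pow_mul_sub_eq_chebyshevDiff_smul {e f a b c d : ℝ} (hef : e * f = 1)
    (hdet : a * d - b * c = 1) (htr : a + d = e + f) (k : ℕ) :
    (!![e, 0; 0, f] * !![a, b; c, d]) ^ k * !![e, 0; 0, f]
        - !![a, b; c, d] * (!![e, 0; 0, f] * !![a, b; c, d]) ^ k
      = chebyshevDiff (e * a + f * d) k • (!![e, 0; 0, f] - !![a, b; c, d]) := by
  induction k using Nat.twoStepInduction with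
  | zero => simp [chebyshevDiff]
  | one =>
    obtain rfl : d = e + f - a := by linarith
    ext i j
    fin_cases i <;> fin_cases j <;> simp [chebyshevDiff]
    · linear_combination f * hdet + (a - e - f) * hef
    · linear_combination b * hef
    · linear_combination c * hef
    · linear_combination e * hdet - a * hef
  | more k ih₀ ih₁ =>
    set x : Matrix (Fin 2) (Fin 2) ℝ := !![e, 0; 0, f] with hx
    set y : Matrix (Fin 2) (Fin 2) ℝ := !![a, b; c, d] with hy
    have hsq : (x * y) ^ 2 = (e * a + f * d) • (x * y) - 1 := by
      ext i j
      fin_cases i <;> fin_cases j <;> simp [hx, hy, pow_two]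
      · linear_combination (-e * f) * hdet - hef
      · ring
      · ring
      · linear_combination (-e * f) * hdet - hef
    have hpow : (x * y) ^ (k + 2) = (e * a + f * d) • (x * y) ^ (k + 1) - (x * y) ^ k := by
      rw [pow_add, hsq, mul_sub, mul_one, mul_smul_comm, ← pow_succ]
    rw [chebyshevDiff, sub_smul, mul_smul, ← ih₀, ← ih₁, hpow]
    simp only [sub_mul, mul_sub, smul_mul_assoc, mul_smul_comm, smul_sub]
    abel

theorem coloring_equation_classification
    (k : ℕ) (hk : 1 ≤ k) (n : ℕ) (hn : n = 2 * k + 1)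
    (r : ℝ) (hr : 0 < r) (a b c d : ℝ)
    (hdet : a * d - b * c = 1) (htr : a + d = 2 * Real.cosh r)
    (x y : Matrix (Fin 2) (Fin 2) ℝ)
    (hx : x = !![Real.exp r, 0; 0, Real.exp (-r)])
    (hy : y = !![a, b; c, d]) :
    (x * y) ^ k * x = y * (x * y) ^ k ↔
      (a = Real.exp r ∧ b = 0 ∧ c = 0 ∧ d = Real.exp (-r)) ∨
      (∃ j : ℕ, Odd j ∧ 1 ≤ j ∧ j ≤ n - 2 ∧
        a = (-Real.exp (-r) * Real.cosh r + Real.cos (2 * (Real.pi * j / (2 * n))))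
              / Real.sinh r ∧
        d = (Real.exp r * Real.cosh r - Real.cos (2 * (Real.pi * j / (2 * n))))
              / Real.sinh r ∧
        b * c = -(4 * Real.sin (Real.pi * j / (2 * n)) ^ 2
              * (Real.sin (Real.pi * j / (2 * n)) ^ 2 + Real.sinh r ^ 2))
              / Real.sinh r ^ 2) := by
  have hef : Real.exp r * Real.exp (-r) = 1 := by rw [← Real.exp_add]; simp
  have hcosh : 2 * Real.cosh r = Real.exp r + Real.exp (-r) := by rw [Real.cosh_eq]; ring
  have hsinh : 2 * Real.sinh r = Real.exp r - Real.exp (-r) := by rw [Real.sinh_eq]; ring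
  have hs : Real.sinh r ≠ 0 := (Real.sinh_pos_iff.2 hr).ne'
  have hxy : x - y = 0 ↔ a = Real.exp r ∧ b = 0 ∧ c = 0 ∧ d = Real.exp (-r) := by
    rw [sub_eq_zero, hx, hy, ← Matrix.ext_iff]
    simp only [Fin.forall_fin_two, Matrix.of_apply, Matrix.cons_val', Matrix.cons_val_zero,
      Matrix.cons_val_one, Matrix.cons_val_fin_one]
    grind
  have hdiff : (x * y) ^ k * x - y * (x * y) ^ k
      = chebyshevDiff (Real.exp r * a + Real.exp (-r) * d) k • (x - y) := by
    rw [hx, hy]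
    exact mul_pow_mul_sub_eq_chebyshevDiff_smul hef hdet (htr.trans hcosh) k
  rw [← sub_eq_zero, hdiff, smul_eq_zero, or_comm, hxy, chebyshevDiff_eq_zero_iff]
  refine or_congr_right (exists_congr fun j => ?_)
  have hn' : (n : ℝ) = 2 * k + 1 := by rw [hn]; push_cast; ring
  have hangle : 2 * (Real.pi * j / (2 * n)) = Real.pi * j / (2 * k + 1) := by
    rw [hn', ← mul_div_assoc, mul_div_mul_left _ _ two_ne_zero]
  have hsin : 2 * Real.sin (Real.pi * j / (2 * n)) ^ 2
      = 1 - Real.cos (Real.pi * j / (2 * k + 1)) := by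
    rw [← hangle, Real.cos_two_mul, Real.cos_sq']; ring
  rw [hangle, eq_div_iff hs, eq_div_iff hs, eq_div_iff (pow_ne_zero 2 hs)]
  generalize Real.cos (Real.pi * j / (2 * k + 1)) = C at hsin ⊢
  generalize Real.sin (Real.pi * j / (2 * n)) = S at hsin ⊢
  generalize Real.cosh r = ch at *
  generalize Real.sinh r = sh at *
  generalize Real.exp r = e at *
  generalize Real.exp (-r) = f at *
  constructor
  · rintro ⟨hj, hlt, ht⟩
    have ha : a * sh = -f * ch + C := by
      linear_combination a / 2 * hsinh + ht / 2 - f / 2 * htr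
    have hd : d * sh = e * ch - C := by
      linear_combination d / 2 * hsinh - ht / 2 + e / 2 * htr
    refine ⟨hj, hj.pos, ?_, ha, hd, ?_⟩
    · obtain ⟨m, rfl⟩ := hj
      omega
    · have hsq : sh ^ 2 = ch ^ 2 - 1 := by
        linear_combination
          (2 * sh + e - f) / 4 * hsinh - (2 * ch + e + f) / 4 * hcosh - hef
      linear_combination d * sh * ha + (-f * ch + C) * hd - sh ^ 2 * hdet
        + (2 * S ^ 2 + (1 - C) + 2 * sh ^ 2) * hsin - C * ch * hcosh - ch ^ 2 * hef
        + (1 - 2 * C) * hsq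
  · rintro ⟨hj, -, hle, ha, hd, -⟩
    refine ⟨hj, by omega, ?_⟩
    have : (e * a + f * d - 2 * C) * sh = 0 := by
      linear_combination e * ha + f * hd - C * hsinh
    linarith [(mul_eq_zero.1 this).resolve_right hs]
end

section
/- Let G be a group, k ≥ 1 an integer, n = 2k+1, and let a, b ∈ G satisfy b·(a·b)^k = (a·b)^k·a. Then (a^{-k}·(a·b)^k) · (a·b^{-k}·(a·b)^k) · a^{-n} = a^{-2n}·(a·b)^n. -/
/-- In the `(2, 2k+1)`-torus knot group, `(ab)^(2k+1)` is the square of `a(ab)^k`. -/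
theorem torusKnot_pow_eq_sq {G : Type*} [Group G] {k : ℕ} {a b : G}
    (hrel : b * (a * b) ^ k = (a * b) ^ k * a) :
    (a * b) ^ (2 * k + 1) = (a * (a * b) ^ k) ^ 2 := by
  calc (a * b) ^ (2 * k + 1) = a * (b * (a * b) ^ k) * (a * b) ^ k := by
        rw [pow_succ', two_mul, pow_add]; simp only [mul_assoc]
    _ = (a * (a * b) ^ k) ^ 2 := by rw [hrel, sq]; simp only [mul_assoc]

/-- In the `(2, 2k+1)`-torus knot group, `(ab)^(2k+1)` commutes with the meridian `a`. -/
theorem torusKnot_commute_pow {G : Type*} [Group G] {k : ℕ} {a b : G}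
    (hrel : b * (a * b) ^ k = (a * b) ^ k * a) :
    Commute a ((a * b) ^ (2 * k + 1)) := by
  have hax : Commute (a * (a * b) ^ k) ((a * b) ^ (2 * k + 1)) := by
    rw [torusKnot_pow_eq_sq hrel]
    exact Commute.self_pow _ 2
  have hx : Commute ((a * b) ^ k) ((a * b) ^ (2 * k + 1)) := Commute.pow_pow_self _ _ _
  simpa using hax.mul_left hx.inv_left

theorem longitude_presentation {G : Type*} [Group G]
    (k : ℕ) (hk : 1 ≤ k) (n : ℕ) (hn : n = 2 * k + 1)
    (a b : G) (hrel : b * (a * b) ^ k = (a * b) ^ k * a) :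
    ((a ^ k)⁻¹ * (a * b) ^ k) * (a * (b ^ k)⁻¹ * (a * b) ^ k) * (a ^ n)⁻¹ =
      (a ^ (2 * n))⁻¹ * (a * b) ^ n := by
  subst hn
  have hcomm := torusKnot_commute_pow hrel
  have hsq := torusKnot_pow_eq_sq hrel
  have hconj : (b ^ k)⁻¹ * (a * b) ^ k = (a * b) ^ k * (a ^ k)⁻¹ := by
    have h : SemiconjBy ((a * b) ^ k) a b := hrel.symm
    exact (h.pow_right k).inv_right.eq.symm
  generalize (a * b) ^ (2 * k + 1) = z at hcomm hsq ⊢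
  generalize (a * b) ^ k = x at hconj hsq ⊢
  have hxax : x * a * x = a⁻¹ * z := by rw [hsq, sq]; group
  calc (a ^ k)⁻¹ * x * (a * (b ^ k)⁻¹ * x) * (a ^ (2 * k + 1))⁻¹
      = (a ^ k)⁻¹ * x * a * ((b ^ k)⁻¹ * x) * (a ^ (2 * k + 1))⁻¹ := by
        simp only [mul_assoc]
    _ = (a ^ k)⁻¹ * (x * a * x) * ((a ^ k)⁻¹ * (a ^ (2 * k + 1))⁻¹) := by
        rw [hconj]; simp only [mul_assoc]
    _ = (a ^ (k + 1))⁻¹ * (z * (a ^ (3 * k + 1))⁻¹) := by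
        rw [hxax, ← mul_inv_rev, ← pow_add, pow_succ' a k, mul_inv_rev,
          show 2 * k + 1 + k = 3 * k + 1 by ring]
        simp only [mul_assoc]
    _ = (a ^ (2 * (2 * k + 1)))⁻¹ * z := by
        rw [← (hcomm.pow_left (3 * k + 1)).inv_left.eq, ← mul_assoc, ← mul_inv_rev, ← pow_add,
          show 3 * k + 1 + (k + 1) = 2 * (2 * k + 1) by ring]
end
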